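/- Let d ≥ 1, n := d(d+1)/2, τ* := n+1, and let ḡ be an admissible metric with diophantine constant γ > 0, i.e. a symmetric positive-definite bilinear form on ℝ^d satisfying |Σ_{i≤j} ḡ_{ij} ℓ_{ij}| ≥ γ·(Σ_{i≤j}|ℓ_{ij}|)^{−τ*} for every nonzero integer vector ℓ ∈ ℤ^n. Fix 0 < ζ₁ < ζ₂ and ζ ∈ (ζ₁,ζ₂), and define Ω_j(ζ) := √(|j|_ḡ⁴ + ζ) for j ∈ ℤ^d. For K ≤ N, let j₁, …, j_K ∈ ℤ^d with |j_i| ≤ N for all i and |j₁|_ḡ < |j₂|_ḡ < ⋯ < |j_K|_ḡ, and let D be the determinant of the K×K matrix whose (n,i) entry (n = 0,…,K−1; i = 1,…,K) is the n-th derivative ∂_ζ^n Ω_{j_i}(ζ). Then there exist constants C > 0 (depending on K, d, γ, τ*, ζ₁, ζ₂) and η > 0 depending only on d (one may take η = τ* + 4) such that |D| ≥ C / N^{η K²}. -/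

import Mathlib

open scoped BigOperators

namespace AG

abbrev Zd (d : ℕ) := Fin d → ℤ

noncomputable def enorm {d : ℕ} (j : Zd d) : ℝ := Real.sqrt (∑ i, ((j i : ℝ))^2)

/-- `|j|_g² = g(j,j)` for a quadratic form with coefficients `g`. -/
noncomputable def qform (d : ℕ) (g : Fin d → Fin d → ℝ) (j : Zd d) : ℝ :=
  ∑ i, ∑ k, g i k * (j i : ℝ) * (j k : ℝ)

/-- `τ* = d(d+1)/2 + 1`. -/
def tauStar (d : ℕ) : ℕ := d * (d + 1) / 2 + 1

/-- `g` is an admissible (γ-diophantine) metric: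
`|Σ_{i≤j} g_{ij} ℓ_{ij}| ≥ γ (Σ_{i≤j}|ℓ_{ij}|)^{−τ*}` for all nonzero `ℓ ∈ ℤ^{d(d+1)/2}`. -/
def Diophantine (d : ℕ) (g : Fin d → Fin d → ℝ) (γ : ℝ) : Prop :=
  ∀ ℓ : Fin d → Fin d → ℤ, (∃ i j, i ≤ j ∧ ℓ i j ≠ 0) →
    γ / (∑ i, ∑ j, if i ≤ j then (|ℓ i j| : ℝ) else 0) ^ tauStar d ≤
      |∑ i, ∑ j, if i ≤ j then g i j * (ℓ i j : ℝ) else 0|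

/-- The (rescaled) beam frequencies `Ω_j(ζ) = √(|j|_ḡ⁴ + ζ)`. -/
noncomputable def beamFreq (d : ℕ) (gbar : Fin d → Fin d → ℝ) (j : Zd d) (ζ : ℝ) : ℝ :=
  Real.sqrt ((qform d gbar j) ^ 2 + ζ)

/-- Coefficients of the iterated derivatives of the square root. -/
noncomputable def cf : ℕ → ℝ
  | 0 => 1
  | (m + 1) => cf m * (1 / 2 - (m : ℝ))

lemma cf_ne (m : ℕ) : cf m ≠ 0 := by
  induction m with
  | zero => simp [cf]
  | succ m ih =>
    refine mul_ne_zero ih ?_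
    intro h
    have h2 : (1 : ℝ) = ((2 * m : ℕ) : ℝ) := by push_cast; linarith
    have h3 : 1 = 2 * m := by exact_mod_cast h2
    omega

lemma iter_sqrt (a : ℝ) (m : ℕ) : ∀ z : ℝ, 0 < a + z →
    iteratedDeriv m (fun z => Real.sqrt (a + z)) z
      = cf m * (Real.sqrt (a + z) * ((a + z)⁻¹) ^ m) := by
  induction m with
  | zero => intro z hz; simp [cf]
  | succ m ih =>
    intro z hz
    rw [iteratedDeriv_succ]
    have hev : iteratedDeriv m (fun z => Real.sqrt (a + z)) =ᶠ[nhds z]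
        fun z => cf m * (Real.sqrt (a + z) * ((a + z)⁻¹) ^ m) := by
      have : ∀ᶠ y in nhds z, 0 < a + y :=
        (continuous_const.add continuous_id).continuousAt.eventually (lt_mem_nhds hz)
      filter_upwards [this] with y hy using ih y hy
    rw [hev.deriv_eq]
    have h0 : HasDerivAt (fun y : ℝ => a + y) 1 z := (hasDerivAt_id z).const_add a
    have h1 := h0.sqrt hz.ne'
    have h2 := (h0.inv hz.ne').pow m
    have h3 := (h1.mul h2).const_mul (cf m)
    have h4 : HasDerivAt (fun z => cf m * (Real.sqrt (a + z) * ((a + z)⁻¹) ^ m)) _ z := h3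
    rw [h4.deriv]
    have hs : 0 < Real.sqrt (a + z) := Real.sqrt_pos.2 hz
    have hsq : Real.sqrt (a + z) ^ 2 = a + z := Real.sq_sqrt hz.le
    simp only [cf, Pi.pow_apply, Pi.inv_apply]
    generalize Real.sqrt (a + z) = s at *
    rw [← hsq]
    cases m with
    | zero => simp; field_simp
    | succ m =>
      simp only [Nat.add_sub_cancel]
      push_cast
      rw [pow_succ _ (m + 1), pow_succ _ m]
      generalize ((s ^ 2)⁻¹) ^ m = w
      field_simp
      ring

lemma det_formula (K : ℕ) (a : Fin K → ℝ) (ζ : ℝ) (h : ∀ i, 0 < a i + ζ) :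
    (Matrix.of fun (m i : Fin K) =>
      iteratedDeriv m (fun z => Real.sqrt (a i + z)) ζ).det
    = (∏ m : Fin K, cf m) * ((∏ i, Real.sqrt (a i + ζ)) *
      ∏ i : Fin K, ∏ k ∈ Finset.Ioi i, ((a k + ζ)⁻¹ - (a i + ζ)⁻¹)) := by
  have e : (Matrix.of fun (m i : Fin K) =>
      iteratedDeriv m (fun z => Real.sqrt (a i + z)) ζ)
      = Matrix.of fun (m i : Fin K) => cf m * (Matrix.of fun (m i : Fin K) =>
        Real.sqrt (a i + ζ) * (Matrix.transpose (Matrix.vandermonde fun i => (a i + ζ)⁻¹)) m i) m i := by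
    ext m i
    simp only [Matrix.of_apply, Matrix.transpose_apply, Matrix.vandermonde_apply]
    exact iter_sqrt _ _ _ (h i)
  rw [e, Matrix.det_mul_column, Matrix.det_mul_row, Matrix.det_transpose,
    Matrix.det_vandermonde]

lemma symm_sum (d : ℕ) (S : Fin d → Fin d → ℝ) (hS : ∀ a b, S a b = S b a) :
    (∑ a, ∑ b, if a ≤ b then (if a = b then 1 else 2) * S a b else 0) = ∑ a, ∑ b, S a b := by
  have h1 : (∑ a, ∑ b, if a ≤ b then (if a = b then 1 else 2) * S a b else 0)
      = (∑ a, ∑ b, if a ≤ b then S a b else 0) + ∑ a, ∑ b, if a < b then S a b else 0 := by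
    simp only [← Finset.sum_add_distrib]
    refine Finset.sum_congr rfl fun a _ => Finset.sum_congr rfl fun b _ => ?_
    rcases lt_trichotomy a b with h | h | h
    · simp [h, h.le, h.ne]; ring
    · simp [h]
    · simp [not_le.2 h, not_lt.2 h.le]
  have h2 : (∑ a, ∑ b, if a < b then S a b else 0) = ∑ a, ∑ b, if b < a then S a b else 0 := by
    rw [Finset.sum_comm]
    refine Finset.sum_congr rfl fun a _ => Finset.sum_congr rfl fun b _ => ?_
    rw [hS]
  rw [h1, h2]
  simp only [← Finset.sum_add_distrib]
  refine Finset.sum_congr rfl fun a _ => Finset.sum_congr rfl fun b _ => ?_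
  rcases le_or_gt a b with h | h
  · simp [h, not_lt.2 h]
  · simp [h, not_le.2 h]

lemma coord_le {d : ℕ} (j : Zd d) (N : ℝ) (h : enorm j ≤ N) (a : Fin d) : |(j a : ℝ)| ≤ N := by
  refine le_trans ?_ h
  unfold enorm
  apply Real.abs_le_sqrt
  exact Finset.single_le_sum (f := fun i => ((j i : ℝ)) ^ 2) (fun i _ => sq_nonneg _)
    (Finset.mem_univ a)

lemma prod_coord_le {d : ℕ} (j : Zd d) (N : ℝ) (h : enorm j ≤ N) (a b : Fin d) :
    |(j a : ℝ) * (j b : ℝ)| ≤ N ^ 2 := by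
  rw [abs_mul, sq]
  exact mul_le_mul (coord_le j N h a) (coord_le j N h b) (abs_nonneg _)
    ((abs_nonneg _).trans (coord_le j N h a))

lemma qform_le {d : ℕ} (g : Fin d → Fin d → ℝ) (j : Zd d) (N : ℝ) (h : enorm j ≤ N) :
    qform d g j ≤ (∑ a, ∑ b, |g a b|) * N ^ 2 := by
  unfold qform
  simp only [Finset.sum_mul]
  refine Finset.sum_le_sum fun a _ => Finset.sum_le_sum fun b _ => ?_
  refine (le_abs_self _).trans ?_
  rw [mul_assoc, abs_mul]
  exact mul_le_mul_of_nonneg_left (prod_coord_le j N h a b) (abs_nonneg _)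

lemma qform_nonneg {d : ℕ} (g : Fin d → Fin d → ℝ)
    (hg : ∀ x : Fin d → ℝ, x ≠ 0 → 0 < ∑ i, ∑ k, g i k * x i * x k) (j : Zd d) :
    0 ≤ qform d g j := by
  by_cases h : (fun i => (j i : ℝ)) = 0
  · have h' : ∀ i, (j i : ℝ) = 0 := fun i => congrFun h i
    simp [qform, h']
  · exact (hg _ h).le

lemma gap {d : ℕ} (g : Fin d → Fin d → ℝ) (hs : ∀ i k, g i k = g k i) (γ : ℝ) (hγ : 0 < γ)
    (hD : Diophantine d g γ) (N : ℝ) (j k : Zd d) (hj : enorm j ≤ N)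
    (hk : enorm k ≤ N) (hlt : qform d g j < qform d g k) :
    γ / (4 * (d : ℝ) ^ 2 * N ^ 2) ^ tauStar d ≤ qform d g k - qform d g j := by
  set ℓ : Fin d → Fin d → ℤ := fun a b => (if a = b then 1 else 2) * (k a * k b - j a * j b) with hℓ
  have hsum : (∑ a, ∑ b, if a ≤ b then g a b * (ℓ a b : ℝ) else 0)
      = qform d g k - qform d g j := by
    have := symm_sum d (fun a b => g a b * ((k a : ℝ) * k b - j a * j b))
      (fun a b => by rw [hs a b]; ring)
    unfold qform
    rw [← Finset.sum_sub_distrib]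
    simp only [← Finset.sum_sub_distrib]
    refine Eq.trans ?_ (this.trans ?_)
    · refine Finset.sum_congr rfl fun a _ => Finset.sum_congr rfl fun b _ => ?_
      split_ifs <;> simp_all <;> ring
    · refine Finset.sum_congr rfl fun a _ => Finset.sum_congr rfl fun b _ => ?_
      ring
  have hne : ∃ a b, a ≤ b ∧ ℓ a b ≠ 0 := by
    by_contra hcon
    push Not at hcon
    have : (∑ a, ∑ b, if a ≤ b then g a b * (ℓ a b : ℝ) else 0) = 0 := by
      refine Finset.sum_eq_zero fun a _ => Finset.sum_eq_zero fun b _ => ?_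
      split_ifs with h
      · rw [hcon a b h]; simp
      · rfl
    rw [hsum] at this
    linarith
  have hmain := hD ℓ hne
  rw [hsum, abs_of_pos (sub_pos.2 hlt)] at hmain
  refine le_trans ?_ hmain
  have hterm : ∀ a b, (0 : ℝ) ≤ if a ≤ b then (|ℓ a b| : ℝ) else 0 := by
    intro a b; split_ifs
    · exact abs_nonneg _
    · exact le_rfl
  have hL : 0 < ∑ a, ∑ b, if a ≤ b then (|ℓ a b| : ℝ) else 0 := by
    obtain ⟨a, b, hab, h⟩ := hne
    refine Finset.sum_pos' (fun a _ => Finset.sum_nonneg fun b _ => hterm a b)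
      ⟨a, Finset.mem_univ _, Finset.sum_pos' (fun b _ => hterm a b) ⟨b, Finset.mem_univ _, ?_⟩⟩
    rw [if_pos hab]
    have : (ℓ a b : ℝ) ≠ 0 := by exact_mod_cast h
    exact abs_pos.2 this
  have hU : (∑ a, ∑ b, if a ≤ b then (|ℓ a b| : ℝ) else 0) ≤ 4 * (d : ℝ) ^ 2 * N ^ 2 := by
    calc _ ≤ ∑ a : Fin d, ∑ b : Fin d, 4 * N ^ 2 := by
          refine Finset.sum_le_sum fun a _ => Finset.sum_le_sum fun b _ => ?_
          have h1 := prod_coord_le k N hk a b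
          have h2 := prod_coord_le j N hj a b
          have h3 := abs_sub ((k a : ℝ) * k b) (j a * j b)
          have h0 := abs_nonneg ((k a : ℝ) * k b - j a * j b)
          have hN := sq_nonneg N
          split_ifs with hh
          · simp only [hℓ]
            push_cast
            rw [abs_mul]
            split_ifs
            · simp only [Int.cast_one, abs_one]; linarith
            · simp only [Int.cast_ofNat, abs_two]; linarith
          · positivity
      _ = _ := by simp; ring
  gcongr

lemma pair_bound (d : ℕ) (hd : 1 ≤ d) (gbar : Fin d → Fin d → ℝ)
    (hs : ∀ i k, gbar i k = gbar k i)
    (hg : ∀ x : Fin d → ℝ, x ≠ 0 → 0 < ∑ i, ∑ k, gbar i k * x i * x k)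
    (γ : ℝ) (hγ : 0 < γ) (hD : Diophantine d gbar γ) (ζ₂ : ℝ) (hζ₂ : 0 < ζ₂) :
    ∃ c : ℝ, 0 < c ∧ c ≤ 1 ∧ ∀ N : ℝ, 1 ≤ N → ∀ ζ : ℝ, 0 < ζ → ζ < ζ₂ →
      ∀ j k : Zd d, enorm j ≤ N → enorm k ≤ N → qform d gbar j < qform d gbar k →
      c / N ^ (4 * tauStar d + 8) ≤
        |(qform d gbar k ^ 2 + ζ)⁻¹ - (qform d gbar j ^ 2 + ζ)⁻¹| := by
  set G := ∑ a, ∑ b, |gbar a b| with hG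
  set M := G ^ 2 + ζ₂ with hM
  have hMpos : 0 < M := by positivity
  have hdpos : (0 : ℝ) < d := by exact_mod_cast hd
  set c0 := (γ / (4 * (d : ℝ) ^ 2) ^ tauStar d) ^ 2 / M ^ 2 with hc0
  have hc0pos : 0 < c0 := by positivity
  refine ⟨min c0 1, lt_min hc0pos one_pos, min_le_right _ _, ?_⟩
  intro N hN ζ hζ hζ2 j k hj hk hlt
  have hNpos : 0 < N := by linarith
  have hgap := gap gbar hs γ hγ hD N j k hj hk hlt
  have hq1 := qform_nonneg gbar hg j
  have hq2 := qform_nonneg gbar hg k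
  have hup : ∀ j : Zd d, enorm j ≤ N → qform d gbar j ^ 2 + ζ ≤ M * N ^ 4 := by
    intro j hj
    have h1 : qform d gbar j ^ 2 ≤ (G * N ^ 2) ^ 2 :=
      pow_le_pow_left₀ (qform_nonneg gbar hg j) (qform_le gbar j N hj) 2
    have h2 : ζ₂ * 1 ≤ ζ₂ * N ^ 4 := mul_le_mul_of_nonneg_left (one_le_pow₀ hN) hζ₂.le
    rw [hM]
    nlinarith
  have hu1 := hup j hj
  have hu2 := hup k hk
  set p := qform d gbar j
  set q := qform d gbar k
  set δ := γ / (4 * (d : ℝ) ^ 2 * N ^ 2) ^ tauStar d with hδ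
  have hδpos : 0 < δ := by positivity
  have hA : 0 < p ^ 2 + ζ := by positivity
  have hB : 0 < q ^ 2 + ζ := by positivity
  have hnum : δ ^ 2 ≤ q ^ 2 - p ^ 2 := by nlinarith
  have e : |(q ^ 2 + ζ)⁻¹ - (p ^ 2 + ζ)⁻¹| = (q ^ 2 - p ^ 2) / ((p ^ 2 + ζ) * (q ^ 2 + ζ)) := by
    have : (q ^ 2 + ζ)⁻¹ - (p ^ 2 + ζ)⁻¹ = -((q ^ 2 - p ^ 2) / ((p ^ 2 + ζ) * (q ^ 2 + ζ))) := by
      field_simp; ring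
    rw [this, abs_neg, abs_of_nonneg]
    have : 0 ≤ q ^ 2 - p ^ 2 := (sq_nonneg δ).trans hnum
    positivity
  rw [e]
  calc min c0 1 / N ^ (4 * tauStar d + 8) ≤ c0 / N ^ (4 * tauStar d + 8) := by
        gcongr; exact min_le_left _ _
    _ = δ ^ 2 / ((M * N ^ 4) * (M * N ^ 4)) := by
        rw [hc0, hδ, mul_pow (4 * (d : ℝ) ^ 2) (N ^ 2)]
        have : N ^ (4 * tauStar d + 8) = ((N ^ 2) ^ tauStar d) ^ 2 * N ^ 8 := by
          rw [← pow_mul, ← pow_mul, ← pow_add]; congr 1; ring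
        rw [this]
        field_simp
    _ ≤ _ := by
        have h0 : 0 ≤ q ^ 2 - p ^ 2 := (sq_nonneg δ).trans hnum
        gcongr

lemma prod_lower (K : ℕ) (b : ℝ) (hb : 0 ≤ b) (hb1 : b ≤ 1) (f : Fin K → Fin K → ℝ)
    (hf : ∀ i k, i < k → b ≤ |f i k|) :
    b ^ (K ^ 2) ≤ |∏ i : Fin K, ∏ k ∈ Finset.Ioi i, f i k| := by
  rw [Finset.abs_prod]
  have h : ∀ i : Fin K, b ^ K ≤ |∏ k ∈ Finset.Ioi i, f i k| := by
    intro i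
    rw [Finset.abs_prod]
    calc b ^ K ≤ b ^ (Finset.Ioi i).card := by
          apply pow_le_pow_of_le_one hb hb1
          simpa using Finset.card_le_univ (Finset.Ioi i)
      _ = ∏ k ∈ Finset.Ioi i, b := by simp
      _ ≤ _ := Finset.prod_le_prod (fun _ _ => hb) fun k hk => hf i k (Finset.mem_Ioi.1 hk)
  calc b ^ (K ^ 2) = ∏ i : Fin K, b ^ K := by simp [← pow_mul, sq]
    _ ≤ _ := Finset.prod_le_prod (fun _ _ => pow_nonneg hb _) fun i _ => h i

/-- Lemma `determinante`, beam equation.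
For an admissible metric `ḡ` and `ζ ∈ (ζ₁,ζ₂)`, the Vandermonde-type determinant of the
matrix `(∂_ζ^n Ω_{j_i}(ζ))_{n,i}` built on `K ≤ N` sites `|j_i| ≤ N` with strictly
increasing `|j_i|_ḡ` is bounded below by `C/N^{ηK²}`, with `η > 0` depending only on `d`. -/
theorem stmt_14 (d : ℕ) (hd : 1 ≤ d) :
    ∃ η : ℝ, 0 < η ∧
      ∀ gbar : Fin d → Fin d → ℝ, (∀ i k, gbar i k = gbar k i) →
        (∀ x : Fin d → ℝ, x ≠ 0 → 0 < ∑ i, ∑ k, gbar i k * x i * x k) →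
      ∀ γ : ℝ, 0 < γ → Diophantine d gbar γ →
      ∀ ζ₁ ζ₂ : ℝ, 0 < ζ₁ → ζ₁ < ζ₂ →
      ∀ K : ℕ, ∃ C : ℝ, 0 < C ∧
        ∀ N : ℕ, K ≤ N →
        ∀ ζ : ℝ, ζ₁ < ζ → ζ < ζ₂ →
        ∀ j : Fin K → Zd d, (∀ i, enorm (j i) ≤ (N : ℝ)) →
          StrictMono (fun i => qform d gbar (j i)) →
          C / (N : ℝ) ^ (η * (K : ℝ) ^ 2) ≤
            |(Matrix.of fun (m i : Fin K) =>
              iteratedDeriv m (fun z => beamFreq d gbar (j i) z) ζ).det| := by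
  refine ⟨((4 * tauStar d + 8 : ℕ) : ℝ), by positivity, ?_⟩
  intro gbar hs hg γ hγ hD ζ₁ ζ₂ hζ₁ hζ₁₂ K
  obtain ⟨c, hc, hc1, hpair⟩ := pair_bound d hd gbar hs hg γ hγ hD ζ₂ (hζ₁.trans hζ₁₂)
  have hcf : 0 < |∏ m : Fin K, cf m| := abs_pos.2 (Finset.prod_ne_zero_iff.2 fun m _ => cf_ne m)
  have hsq : 0 < Real.sqrt ζ₁ := Real.sqrt_pos.2 hζ₁
  refine ⟨|∏ m : Fin K, cf m| * (Real.sqrt ζ₁ ^ K * c ^ (K ^ 2)), by positivity, ?_⟩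
  intro N hKN ζ hζ hζ2 j hj hmono
  have hζpos : 0 < ζ := hζ₁.trans hζ
  have hdet := det_formula K (fun i => qform d gbar (j i) ^ 2) ζ (fun i => by positivity)
  simp only [beamFreq]
  rw [hdet, abs_mul, abs_mul]
  have hpow : (N : ℝ) ^ (((4 * tauStar d + 8 : ℕ) : ℝ) * (K : ℝ) ^ 2)
      = ((N : ℝ) ^ (4 * tauStar d + 8)) ^ (K ^ 2) := by
    have hh : ((4 * tauStar d + 8 : ℕ) : ℝ) * (K : ℝ) ^ 2
        = (((4 * tauStar d + 8) * K ^ 2 : ℕ) : ℝ) := by push_cast; rfl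
    rw [hh, Real.rpow_natCast, pow_mul]
  rw [hpow, mul_div_assoc, mul_div_assoc, ← div_pow]
  have h1 : Real.sqrt ζ₁ ^ K ≤ |∏ i, Real.sqrt (qform d gbar (j i) ^ 2 + ζ)| := by
    rw [Finset.abs_prod]
    calc Real.sqrt ζ₁ ^ K = ∏ i : Fin K, Real.sqrt ζ₁ := by simp
      _ ≤ _ := Finset.prod_le_prod (fun _ _ => hsq.le) fun i _ => by
        rw [abs_of_nonneg (Real.sqrt_nonneg _)]
        apply Real.sqrt_le_sqrt
        nlinarith [sq_nonneg (qform d gbar (j i))]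
  have h2 : (c / (N : ℝ) ^ (4 * tauStar d + 8)) ^ (K ^ 2) ≤
      |∏ i : Fin K, ∏ k ∈ Finset.Ioi i,
        ((qform d gbar (j k) ^ 2 + ζ)⁻¹ - (qform d gbar (j i) ^ 2 + ζ)⁻¹)| := by
    rcases Nat.eq_zero_or_pos K with h0 | h0
    · subst h0; simp
    have hN : (1 : ℝ) ≤ N := by exact_mod_cast (h0.trans_le hKN)
    apply prod_lower
    · positivity
    · exact (div_le_self hc.le (one_le_pow₀ hN)).trans hc1
    · intro i k hik
      exact hpair N hN ζ hζpos hζ2 (j i) (j k) (hj i) (hj k) (hmono hik)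
  gcongr

end AG
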